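/- arXiv:1204.1933 — 3 statements merged into one kernel-verified Lean document; each statement's English description precedes it below -/
import Mathlib

section
/- For every λ > 0 there are only finitely many perfect forms in the Ryshkov polytope R_λ up to unimodular equivalence: there exists a finite set Φ of perfect forms such that every perfect form G ∈ R_λ can be written as G = Zᵀ G₀ Z for some G₀ ∈ Φ and some unimodular integer matrix Z. -/
open Matrix

/-- The quadratic form `eᵀ G e` evaluated at an integer vector `e`. -/
def intQuadForm {N : ℕ} (G : Matrix (Fin N) (Fin N) ℝ) (e : Fin N → ℤ) : ℝ :=
  (fun i => (e i : ℝ)) ⬝ᵥ G.mulVec fun i => (e i : ℝ)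

/-- The Ryshkov polytope `R_λ`. -/
def Ryshkov (N : ℕ) (lam : ℝ) : Set (Matrix (Fin N) (Fin N) ℝ) :=
  {G | G.IsSymm ∧ ∀ e : Fin N → ℤ, e ≠ 0 → lam ≤ intQuadForm G e}

/-- The set of minimum vectors of `G` at level `λ`. -/
def MinVecs {N : ℕ} (G : Matrix (Fin N) (Fin N) ℝ) (lam : ℝ) : Set (Fin N → ℤ) :=
  {e | e ≠ 0 ∧ intQuadForm G e = lam}

/-- `G` is a perfect form in `R_λ`: it lies in `R_λ`, has at least one minimum
vector, and is the unique real symmetric matrix `G'` with `eᵀG'e = λ` for all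
minimum vectors `e` of `G`. -/
def IsPerfectForm {N : ℕ} (lam : ℝ) (G : Matrix (Fin N) (Fin N) ℝ) : Prop :=
  G ∈ Ryshkov N lam ∧ (MinVecs G lam).Nonempty ∧
    ∀ G' : Matrix (Fin N) (Fin N) ℝ, G'.IsSymm →
      (∀ e ∈ MinVecs G lam, intQuadForm G' e = lam) → G' = G

/-- A unimodular matrix: integer entries and determinant `±1`. -/
def IsUnimodular {N : ℕ} (Z : Matrix (Fin N) (Fin N) ℤ) : Prop :=
  Z.det = 1 ∨ Z.det = -1

open MeasureTheory

theorem intQuadForm_nonneg_of_mem_ryshkov {N : ℕ} {lam : ℝ} (hlam : 0 < lam)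
    {G : Matrix (Fin N) (Fin N) ℝ} (hG : G ∈ Ryshkov N lam) (e : Fin N → ℤ) :
    0 ≤ intQuadForm G e := by
  by_cases he : e = 0
  · subst he
    simp [intQuadForm, dotProduct]
  · exact hlam.le.trans (hG.2 e he)

theorem intQuadForm_transpose_mul_mul {N : ℕ} (G : Matrix (Fin N) (Fin N) ℝ)
    (Z : Matrix (Fin N) (Fin N) ℤ) (e : Fin N → ℤ) :
    intQuadForm ((Z.map (Int.cast : ℤ → ℝ))ᵀ * G * Z.map (Int.cast : ℤ → ℝ)) e =
      intQuadForm G (Z *ᵥ e) := by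
  have h : (fun i => ((Z *ᵥ e) i : ℝ)) =
      Z.map (Int.cast : ℤ → ℝ) *ᵥ fun i => (e i : ℝ) := by
    ext i
    simp [mulVec, dotProduct]
  rw [intQuadForm, intQuadForm, h, ← mulVec_mulVec, ← mulVec_mulVec, mulVec_transpose,
    dotProduct_comm, ← dotProduct_mulVec, dotProduct_comm]

theorem abs_bilin_minVecs_le {N : ℕ} {lam : ℝ} (hlam : 0 < lam)
    {G : Matrix (Fin N) (Fin N) ℝ} (hG : G ∈ Ryshkov N lam) {e f : Fin N → ℤ}
    (he : e ∈ MinVecs G lam) (hf : f ∈ MinVecs G lam) :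
    |(fun i => (e i : ℝ)) ⬝ᵥ G *ᵥ fun i => (f i : ℝ)| ≤ lam := by
  have hsymm : (fun i => (f i : ℝ)) ⬝ᵥ G *ᵥ (fun i => (e i : ℝ)) =
      (fun i => (e i : ℝ)) ⬝ᵥ G *ᵥ fun i => (f i : ℝ) := by
    rw [dotProduct_comm, ← vecMul_transpose, hG.1.eq, ← dotProduct_mulVec]
  have hadd := intQuadForm_nonneg_of_mem_ryshkov hlam hG (e + f)
  have hsub := intQuadForm_nonneg_of_mem_ryshkov hlam hG (e - f)
  have h1 : (fun i => (((e + f) i : ℤ) : ℝ)) = (fun i => (e i : ℝ)) + fun i => (f i : ℝ) := by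
    ext i; simp
  have h2 : (fun i => (((e - f) i : ℤ) : ℝ)) = (fun i => (e i : ℝ)) - fun i => (f i : ℝ) := by
    ext i; simp
  have he' := he.2
  have hf' := hf.2
  simp only [intQuadForm] at he' hf' hadd hsub
  rw [h1, mulVec_add, add_dotProduct, dotProduct_add, dotProduct_add, he', hf', hsymm] at hadd
  rw [h2, mulVec_sub, sub_dotProduct, dotProduct_sub, dotProduct_sub, he', hf', hsymm] at hsub
  rw [abs_le]
  constructor <;> linarith

theorem dotProduct_mulVec_lt_of_abs_lt {N : ℕ} {lam : ℝ} (hlam : 0 < lam)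
    {B : Matrix (Fin N) (Fin N) ℝ} (hB : ∀ i j, |B i j| ≤ lam) {c : Fin N → ℝ}
    (hc : ∑ i, |c i| < 1) : c ⬝ᵥ B *ᵥ c < lam := by
  calc c ⬝ᵥ B *ᵥ c = ∑ i, ∑ j, c i * (B i j * c j) := by
        simp [dotProduct, mulVec, Finset.mul_sum]
    _ ≤ ∑ i, ∑ j, |c i| * (lam * |c j|) := by
        refine Finset.sum_le_sum fun i _ => Finset.sum_le_sum fun j _ => ?_
        refine (le_abs_self _).trans ?_
        rw [abs_mul, abs_mul]
        gcongr
        exact hB i j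
    _ = lam * (∑ i, |c i|) ^ 2 := by
        rw [sq, Finset.sum_mul_sum, Finset.mul_sum]
        refine Finset.sum_congr rfl fun i _ => ?_
        rw [Finset.mul_sum]
        exact Finset.sum_congr rfl fun j _ => by ring
    _ < lam := by
        have h0 : 0 ≤ ∑ i, |c i| := Finset.sum_nonneg fun i _ => abs_nonneg _
        have : (∑ i, |c i|) ^ 2 < 1 := by nlinarith
        nlinarith

theorem exists_int_mem_image_cube {N : ℕ} (hN : 0 < N) (A : Matrix (Fin N) (Fin N) ℝ)
    (hA : (N : ℝ) ^ N < |A.det|) :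
    ∃ e : Fin N → ℤ, e ≠ 0 ∧ ∃ c : Fin N → ℝ, (∀ i, |c i| < 1 / N) ∧
      A *ᵥ c = fun i => (e i : ℝ) := by
  have hN' : (0 : ℝ) < N := by exact_mod_cast hN
  set cube : Set (Fin N → ℝ) := Set.univ.pi fun _ => Set.Ioo (-(1 / N : ℝ)) (1 / N) with hcube
  have hmem : ∀ c, c ∈ cube ↔ ∀ i, |c i| < 1 / N := by
    intro c
    simp only [hcube, Set.mem_univ_pi, Set.mem_Ioo, abs_lt]
  set s : Set (Fin N → ℝ) := Matrix.toLin' A '' cube with hs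
  have hsymm : ∀ x ∈ s, -x ∈ s := by
    rintro _ ⟨c, hc, rfl⟩
    refine ⟨-c, ?_, map_neg _ _⟩
    rw [hmem] at hc ⊢
    simpa using hc
  have hconv : Convex ℝ s :=
    (convex_pi fun _ _ => convex_Ioo _ _).linear_image _
  have hfund := ZSpan.isAddFundamentalDomain' (Pi.basisFun ℝ (Fin N)) volume
  have hvol : volume (ZSpan.fundamentalDomain (Pi.basisFun ℝ (Fin N))) *
      2 ^ Module.finrank ℝ (Fin N → ℝ) < volume s := by
    rw [hs, Measure.addHaar_image_linearMap, ZSpan.volume_fundamentalDomain, hcube,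
      Real.volume_pi_Ioo, LinearMap.det_toLin']
    have h1 : |(Matrix.of ⇑(Pi.basisFun ℝ (Fin N))).det| = 1 := by
      have : Matrix.of ⇑(Pi.basisFun ℝ (Fin N)) = 1 := by
        ext i j
        simp [Matrix.one_apply, Pi.single_apply, eq_comm]
      simp [this]
    rw [h1, Finset.prod_const, Finset.card_univ, Fintype.card_fin, Module.finrank_fin_fun,
      ENNReal.ofReal_one, one_mul, ← ENNReal.ofReal_pow (by rw [sub_neg_eq_add]; positivity),
      ← ENNReal.ofReal_mul (abs_nonneg _)]
    have h2 : (2 : ENNReal) ^ N = ENNReal.ofReal (2 ^ N) := by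
      rw [ENNReal.ofReal_pow (by norm_num)]; norm_num
    rw [h2, ENNReal.ofReal_lt_ofReal_iff_of_nonneg (by positivity)]
    calc (2 : ℝ) ^ N = (N : ℝ) ^ N * (1 / N - -(1 / N)) ^ N := by
          rw [← mul_pow]; congr 1; field_simp; norm_num
      _ < |A.det| * (1 / N - -(1 / N)) ^ N := by
          have h3 : (0 : ℝ) < (1 / N - -(1 / N)) ^ N := by
            rw [sub_neg_eq_add]
            positivity
          gcongr
  have : Countable (Submodule.span ℤ (Set.range (Pi.basisFun ℝ (Fin N)))).toAddSubgroup :=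
    inferInstanceAs (Countable (Submodule.span ℤ (Set.range (Pi.basisFun ℝ (Fin N)))))
  obtain ⟨x, hx0, c, hc, hcx⟩ :=
    exists_ne_zero_mem_lattice_of_measure_mul_two_pow_lt_measure hfund hsymm hconv hvol
  have hx := x.2
  replace hx : (x : Fin N → ℝ) ∈ Submodule.span ℤ (Set.range (Pi.basisFun ℝ (Fin N))) := hx
  rw [Module.Basis.mem_span_iff_repr_mem] at hx
  choose e he using hx
  have hxe : (x : Fin N → ℝ) = fun i => (e i : ℝ) := by
    ext i
    simpa using (he i).symm
  refine ⟨e, ?_, c, (hmem c).1 hc, ?_⟩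
  · rintro rfl
    apply hx0
    ext i
    simp [hxe]
  · rw [← hxe, ← hcx, Matrix.toLin'_apply]

/-- Minkowski's theorem bounds the determinant of any `N` minimum vectors. -/
theorem abs_det_le_of_cols_mem_minVecs {N : ℕ} {lam : ℝ} (hlam : 0 < lam)
    {G : Matrix (Fin N) (Fin N) ℝ} (hG : G ∈ Ryshkov N lam) {M : Matrix (Fin N) (Fin N) ℤ}
    (hM : ∀ j, M.col j ∈ MinVecs G lam) : |M.det| ≤ (N : ℤ) ^ N := by
  rcases Nat.eq_zero_or_pos N with rfl | hN
  · simp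
  by_contra! hdet
  set A : Matrix (Fin N) (Fin N) ℝ := M.map (Int.cast : ℤ → ℝ) with hA
  have hdetA : A.det = (M.det : ℝ) := by
    rw [hA, Int.cast_det]
  obtain ⟨e, he0, c, hc, hce⟩ := exists_int_mem_image_cube hN A (by
    rw [hdetA]
    exact_mod_cast hdet)
  have hsum : ∑ i, |c i| < 1 := by
    have : Nonempty (Fin N) := ⟨⟨0, hN⟩⟩
    calc ∑ i, |c i| < ∑ _i : Fin N, (1 / N : ℝ) :=
          Finset.sum_lt_sum_of_nonempty Finset.univ_nonempty fun i _ => hc i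
      _ = 1 := by
          have : (N : ℝ) ≠ 0 := by positivity
          simp [this]
  have hB : ∀ i j, |(Aᵀ * G * A) i j| ≤ lam := by
    intro i j
    convert abs_bilin_minVecs_le hlam hG (hM i) (hM j) using 2
    rw [Matrix.mul_assoc, Matrix.mul_apply]
    simp only [dotProduct, mulVec, Matrix.mul_apply]
    rfl
  have hlt := dotProduct_mulVec_lt_of_abs_lt hlam hB hsum
  have hq : c ⬝ᵥ (Aᵀ * G * A) *ᵥ c = intQuadForm G e := by
    rw [intQuadForm, ← hce, ← mulVec_mulVec, ← mulVec_mulVec, mulVec_transpose,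
      dotProduct_comm, ← dotProduct_mulVec, dotProduct_comm]
  rw [hq] at hlt
  exact absurd (hG.2 e he0) (not_le.2 hlt)

theorem IsPerfectForm.span_minVecs_eq_top {N : ℕ} {lam : ℝ} {G : Matrix (Fin N) (Fin N) ℝ}
    (hG : IsPerfectForm lam G) :
    Submodule.span ℝ ((fun (e : Fin N → ℤ) i => (e i : ℝ)) '' MinVecs G lam) = ⊤ := by
  by_contra hne
  obtain ⟨f, hf0, hf⟩ := Submodule.exists_le_ker_of_lt_top _ (lt_top_iff_ne_top.2 hne)
  set w : Fin N → ℝ := fun i => f (Pi.single i 1) with hw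
  have hfw : ∀ x, f x = w ⬝ᵥ x := by
    intro x
    rw [LinearMap.pi_apply_eq_sum_univ f x]
    refine Finset.sum_congr rfl fun i _ => ?_
    rw [smul_eq_mul, mul_comm, hw]
    congr 2
    ext j
    simp [Pi.single_apply, eq_comm]
  have hsymm : (G + vecMulVec w w).IsSymm :=
    hG.1.1.add (by ext i j; simp [vecMulVec_apply, mul_comm])
  have heq := hG.2.2 _ hsymm fun e he => by
    have hfe : w ⬝ᵥ (fun i => (e i : ℝ)) = 0 := by
      rw [← hfw]
      exact hf (Submodule.subset_span ⟨e, he, rfl⟩)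
    rw [intQuadForm, add_mulVec, vecMulVec_mulVec, hfe]
    simpa [intQuadForm] using he.2
  rw [add_eq_left] at heq
  apply hf0
  ext i
  have := congr_fun (congr_fun heq i) i
  simpa [vecMulVec_apply, hw] using this

theorem IsPerfectForm.exists_cols_mem_minVecs {N : ℕ} {lam : ℝ}
    {G : Matrix (Fin N) (Fin N) ℝ} (hG : IsPerfectForm lam G) :
    ∃ M : Matrix (Fin N) (Fin N) ℤ, M.det ≠ 0 ∧ ∀ j, M.col j ∈ MinVecs G lam := by
  obtain ⟨v, hv, -, hli⟩ := Submodule.exists_fun_fin_finrank_span_eq ℝ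
    ((fun (e : Fin N → ℤ) i => (e i : ℝ)) '' MinVecs G lam)
  have hrank : Module.finrank ℝ (Submodule.span ℝ
      ((fun (e : Fin N → ℤ) i => (e i : ℝ)) '' MinVecs G lam)) = N := by
    rw [hG.span_minVecs_eq_top, finrank_top, Module.finrank_fin_fun]
  choose u hu huv using hv
  let M : Matrix (Fin N) (Fin N) ℤ := (Matrix.of fun j => u (Fin.cast hrank.symm j))ᵀ
  refine ⟨M, fun h => ?_, fun j => hu _⟩
  have hli' : LinearIndependent ℝ (M.map (Int.cast : ℤ → ℝ)).col := by
    have hcol : (M.map (Int.cast : ℤ → ℝ)).col = v ∘ Fin.cast hrank.symm := by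
      ext j i
      simp [M, ← huv]
    rw [hcol]
    exact hli.comp _ (Fin.cast_injective _)
  rw [linearIndependent_cols_iff_isUnit, isUnit_iff_isUnit_det, ← Int.cast_det, h] at hli'
  simp at hli'

/-- Two perfect forms are equivalent as soon as bases of minimum vectors agree modulo their
common determinant and the minimum vectors have the same coordinates in these bases. -/
theorem IsPerfectForm.exists_isUnimodular {N : ℕ} {lam : ℝ} {G G' : Matrix (Fin N) (Fin N) ℝ}
    (hG : IsPerfectForm lam G) {M M' : Matrix (Fin N) (Fin N) ℤ} (hM : M.det ≠ 0)
    (hdet : M.det = M'.det)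
    (hadj : ∀ i j, M.adjugate i j % M.det = M'.adjugate i j % M'.det)
    (hmin : (M.adjugate *ᵥ ·) '' MinVecs G lam = (M'.adjugate *ᵥ ·) '' MinVecs G' lam)
    (hG' : G'.IsSymm) :
    ∃ Z : Matrix (Fin N) (Fin N) ℤ, IsUnimodular Z ∧
      G = (Z.map (Int.cast : ℤ → ℝ))ᵀ * G' * Z.map (Int.cast : ℤ → ℝ) := by
  have hdvd : ∀ i j, ∃ q, M.adjugate i j = M'.adjugate i j + M.det * q := by
    intro i j
    have h : M'.adjugate i j ≡ M.adjugate i j [ZMOD M.det] := by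
      have := hadj i j
      rw [← hdet] at this
      exact this.symm
    obtain ⟨q, hq⟩ := h.dvd
    exact ⟨q, by linarith⟩
  choose Q hQ using hdvd
  set Z : Matrix (Fin N) (Fin N) ℤ := 1 + M' * Matrix.of Q with hZ
  have hMZ : M' * M.adjugate = M.det • Z := by
    have h : M.adjugate = M'.adjugate + M.det • Matrix.of Q := by
      ext i j
      simpa using hQ i j
    rw [h, Matrix.mul_add, mul_adjugate, ← hdet, Matrix.mul_smul, hZ, smul_add]
  have hZM : Z * M = M' := by
    apply smul_right_injective _ hM
    simp only
    rw [← Matrix.smul_mul, ← hMZ, Matrix.mul_assoc, adjugate_mul, Matrix.mul_smul, Matrix.mul_one]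
  have hZdet : Z.det = 1 := by
    have h := congr_arg Matrix.det hZM
    rw [det_mul, ← hdet] at h
    exact mul_right_cancel₀ hM (by rw [h, one_mul])
  refine ⟨Z, Or.inl hZdet, (hG.2.2 _ ?_ fun e he => ?_).symm⟩
  · rw [Matrix.IsSymm, transpose_mul, transpose_mul, transpose_transpose, hG'.eq, Matrix.mul_assoc]
  · rw [intQuadForm_transpose_mul_mul]
    obtain ⟨e', he', hee'⟩ : M.adjugate *ᵥ e ∈ (M'.adjugate *ᵥ ·) '' MinVecs G' lam :=
      hmin ▸ ⟨e, he, rfl⟩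
    have h : Z *ᵥ e = e' := by
      apply smul_right_injective _ hM
      simp only at hee' ⊢
      rw [← smul_mulVec, ← hMZ, ← mulVec_mulVec, ← hee', mulVec_mulVec, mul_adjugate,
        smul_mulVec, one_mulVec, hdet]
    rw [h]
    exact he'.2

/-- for every `λ > 0` there are only finitely many perfect forms in
`R_λ` up to unimodular equivalence. -/
theorem finitely_many_perfect_forms (N : ℕ) (lam : ℝ) (hlam : 0 < lam) :
    ∃ Φ : Set (Matrix (Fin N) (Fin N) ℝ), Φ.Finite ∧
      (∀ G₀ ∈ Φ, IsPerfectForm lam G₀) ∧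
      ∀ G : Matrix (Fin N) (Fin N) ℝ, G ∈ Ryshkov N lam → IsPerfectForm lam G →
        ∃ G₀ ∈ Φ, ∃ Z : Matrix (Fin N) (Fin N) ℤ, IsUnimodular Z ∧
          G = (Z.map (Int.cast : ℤ → ℝ))ᵀ * G₀ * Z.map (Int.cast : ℤ → ℝ) := by
  have hex : ∀ G : {G : Matrix (Fin N) (Fin N) ℝ // IsPerfectForm lam G},
      ∃ M : Matrix (Fin N) (Fin N) ℤ, M.det ≠ 0 ∧ ∀ j, M.col j ∈ MinVecs G.1 lam :=
    fun G => G.2.exists_cols_mem_minVecs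
  choose M hM0 hM using hex
  have hMdet : ∀ G, |(M G).det| ≤ (N : ℤ) ^ N := fun G =>
    abs_det_le_of_cols_mem_minVecs hlam G.2.1 (hM G)
  have hcoord : ∀ G, ∀ e ∈ MinVecs G.1 lam, ∀ i,
      |((M G).adjugate *ᵥ e) i| ≤ (N : ℤ) ^ N := by
    intro G e he i
    rw [← cramer_eq_adjugate_mulVec, cramer_apply]
    refine abs_det_le_of_cols_mem_minVecs hlam G.2.1 fun j => ?_
    by_cases hj : j = i
    · subst hj
      convert he using 1
      ext k
      simp
    · convert hM G j using 1
      ext k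
      simp [hj]
  set f : {G : Matrix (Fin N) (Fin N) ℝ // IsPerfectForm lam G} →
      ℤ × (Fin N → Fin N → ℤ) × Set (Fin N → ℤ) := fun G =>
    ((M G).det, fun i j => (M G).adjugate i j % (M G).det,
      ((M G).adjugate *ᵥ ·) '' MinVecs G.1 lam) with hf
  have hfin : (Set.range f).Finite := by
    have hI : (Set.Icc (-(N : ℤ) ^ N) ((N : ℤ) ^ N)).Finite := Set.finite_Icc _ _
    refine (hI.prod ((Set.Finite.pi' fun _ => Set.Finite.pi' fun _ => hI).prod
      (Set.Finite.pi' fun _ : Fin N => hI).finite_subsets)).subset ?_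
    rintro _ ⟨G, rfl⟩
    refine ⟨abs_le.1 (hMdet G), fun i j => ?_, ?_⟩
    · have h1 := Int.emod_nonneg ((M G).adjugate i j) (hM0 G)
      have h2 := Int.emod_lt_abs ((M G).adjugate i j) (hM0 G)
      have h3 := hMdet G
      have h4 : (0 : ℤ) ≤ (N : ℤ) ^ N := by positivity
      exact ⟨(by linarith : -(N : ℤ) ^ N ≤ _ % _), (h2.trans_le h3).le⟩
    · rintro _ ⟨e, he, rfl⟩ i
      exact abs_le.1 (hcoord G e he i)
  have : Finite (Set.range f) := hfin
  refine ⟨Set.range fun y : Set.range f => (Set.rangeSplitting f y).1, Set.finite_range _, ?_, ?_⟩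
  · rintro _ ⟨y, rfl⟩
    exact (Set.rangeSplitting f y).2
  · intro G _ hG
    refine ⟨_, ⟨⟨f ⟨G, hG⟩, Set.mem_range_self _⟩, rfl⟩, ?_⟩
    set G₀ := Set.rangeSplitting f ⟨f ⟨G, hG⟩, Set.mem_range_self _⟩ with hG₀
    have heq : f G₀ = f ⟨G, hG⟩ := Set.apply_rangeSplitting f _
    simp only [hf, Prod.mk.injEq] at heq
    exact hG.exists_isUnimodular (hM0 ⟨G, hG⟩) heq.1.symm
      (fun i j => (congr_fun (congr_fun heq.2.1 i) j).symm) heq.2.2.symm G₀.2.1.1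
end

section
/- Upper bound on the optimal transmit power: let S be a real N×N diagonal matrix with positive diagonal entries. There exists a real N×N matrix F such that the squared minimum distance of the received lattice satisfies ‖SFe‖² ≥ 1 for every nonzero integer vector e ∈ ℤ^N, and tr(FᵀF) ≤ N · (1/det S)^{2/N}. Consequently the optimal value of the minimum-power problem min tr(FᵀF) subject to ‖SFe‖² ≥ 1 for all e ∈ ℤ^N \ {0} is at most N · (det S)^{−2/N}. -/
open Matrix

/-- If positive reals have product one, then some convex combination of them is equal to one. -/
lemma exists_convex_weights_of_prod_eq_one {ι : Type*} [Fintype ι] [Nonempty ι]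
    (d : ι → ℝ) (hd : ∀ i, 0 < d i) (h : ∏ i, d i = 1) :
    ∃ p : ι → ℝ, (∀ i, 0 ≤ p i) ∧ ∑ i, p i = 1 ∧ ∑ i, p i * d i = 1 := by
  classical
  obtain ⟨i, hi⟩ : ∃ i, d i ≤ 1 := by
    by_contra! hc
    have := Finset.prod_lt_prod_of_nonempty (s := Finset.univ) (f := fun _ : ι => (1 : ℝ)) (g := d)
      (fun _ _ => one_pos) (fun i _ => hc i) Finset.univ_nonempty
    simp [h] at this
  obtain ⟨j, hj⟩ : ∃ j, 1 ≤ d j := by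
    by_contra! hc
    have := Finset.prod_lt_prod_of_nonempty (s := Finset.univ) (f := d) (g := fun _ : ι => (1 : ℝ))
      (fun i _ => hd i) (fun i _ => hc i) Finset.univ_nonempty
    simp [h] at this
  have hm : (1 : ℝ) ∈ segment ℝ (d i) (d j) := by
    rw [segment_eq_Icc (hi.trans hj)]
    exact ⟨hi, hj⟩
  obtain ⟨a, b, ha, hb, hab, hs⟩ := hm
  refine ⟨fun k => a * (if k = i then 1 else 0) + b * (if k = j then 1 else 0), ?_, ?_, ?_⟩
  · intro k
    dsimp only
    split_ifs <;> positivity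
  · simp [Finset.sum_add_distrib, hab]
  · simpa [Finset.sum_add_distrib, add_mul] using hs

/-- A positive definite matrix of determinant one takes the value one at some unit vector. -/
lemma Matrix.PosDef.exists_unit_vector_quadForm_eq_one {ι : Type*} [Fintype ι] [DecidableEq ι]
    [Nonempty ι] {A : Matrix ι ι ℝ} (hA : A.PosDef) (hdet : A.det = 1) :
    ∃ w : ι → ℝ, w ⬝ᵥ w = 1 ∧ w ⬝ᵥ (A *ᵥ w) = 1 := by
  obtain ⟨p, hp, hp1, hpd⟩ := exists_convex_weights_of_prod_eq_one hA.1.eigenvalues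
    hA.eigenvalues_pos (by simpa [hA.1.det_eq_prod_eigenvalues] using hdet)
  set U : Matrix ι ι ℝ := (hA.1.eigenvectorUnitary : Matrix ι ι ℝ)
  have hUU : Uᵀ * U = 1 := by
    have := Unitary.coe_star_mul_self hA.1.eigenvectorUnitary
    rwa [star_eq_conjTranspose, conjTranspose_eq_transpose_of_trivial] at this
  have hspec : A = U * diagonal hA.1.eigenvalues * Uᵀ := by
    have := hA.1.spectral_theorem
    rw [Unitary.conjStarAlgAut_apply, star_eq_conjTranspose,
      conjTranspose_eq_transpose_of_trivial] at this
    exact this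
  have hq : ∀ i, √(p i) * √(p i) = p i := fun i => Real.mul_self_sqrt (hp i)
  set q : ι → ℝ := fun i => √(p i)
  refine ⟨U *ᵥ q, ?_, ?_⟩
  · rw [dotProduct_mulVec, ← mulVec_transpose, mulVec_mulVec, hUU, one_mulVec]
    simpa [dotProduct, q, hq] using hp1
  · have h1 : A *ᵥ (U *ᵥ q) = U *ᵥ (diagonal hA.1.eigenvalues *ᵥ q) := by
      conv_lhs => rw [hspec]
      rw [mulVec_mulVec, Matrix.mul_assoc, hUU, Matrix.mul_one, ← mulVec_mulVec]
    rw [h1, dotProduct_mulVec, ← mulVec_transpose, mulVec_mulVec, hUU, one_mulVec, ← hpd]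
    refine Finset.sum_congr rfl fun i _ => ?_
    rw [mulVec_diagonal, ← hq i]
    ring

/-- Every unit vector is the column with a prescribed index of some orthogonal matrix. -/
lemma exists_orthogonal_matrix_col_eq {ι : Type*} [Fintype ι] [DecidableEq ι] (i₀ : ι)
    (w : ι → ℝ) (hw : w ⬝ᵥ w = 1) :
    ∃ Q : Matrix ι ι ℝ, Qᵀ * Q = 1 ∧ ∀ i, Q i i₀ = w i := by
  have ho : Orthonormal ℝ (({i₀} : Set ι).domRestrict
      (fun _ : ι => (WithLp.toLp 2 w : EuclideanSpace ℝ ι))) := by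
    refine ⟨fun _ => ?_, fun i j hij => (hij (Subsingleton.elim i j)).elim⟩
    simp only [Set.domRestrict_apply, EuclideanSpace.norm_eq, Real.norm_eq_abs, sq_abs]
    rw [← Real.sqrt_one, ← hw]
    simp [dotProduct, sq]
  obtain ⟨b, hb⟩ := ho.exists_orthonormalBasis_extension_of_card_eq (by simp)
  refine ⟨Matrix.of fun i j => b j i, ?_, fun i => ?_⟩
  · ext i j
    have := orthonormal_iff_ite.1 b.orthonormal i j
    simp only [PiLp.inner_apply, RCLike.inner_apply, conj_trivial] at this
    rw [one_apply, ← this, mul_apply]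
    exact Finset.sum_congr rfl fun k _ => mul_comm _ _
  · simp [hb i₀ rfl]

/-- The Schur complement of the top left entry, for a matrix in which this entry is one. -/
def schurComplementZero {n : ℕ} (B : Matrix (Fin (n + 1)) (Fin (n + 1)) ℝ) :
    Matrix (Fin n) (Fin n) ℝ :=
  Matrix.of fun i j => B i.succ j.succ - B i.succ 0 * B 0 j.succ

lemma det_schurComplementZero {n : ℕ} {B : Matrix (Fin (n + 1)) (Fin (n + 1)) ℝ}
    (h : B 0 0 = 1) : (schurComplementZero B).det = B.det := by
  have h1 : B.det =
      (Matrix.of (Fin.cons (B 0) fun i j => B i.succ j - B i.succ 0 * B 0 j)).det := by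
    refine det_eq_of_forall_row_eq_smul_add_const (Fin.cons 0 fun i => B i.succ 0) 0 rfl ?_
    intro i j
    cases i using Fin.cases <;> simp
  rw [h1, det_succ_column_zero, Fin.sum_univ_succ]
  simp only [of_apply, Fin.cons_zero, Fin.cons_succ, h]
  simp
  rfl

lemma quadForm_cons {n : ℕ} {B : Matrix (Fin (n + 1)) (Fin (n + 1)) ℝ}
    (hB : B.IsSymm) (h : B 0 0 = 1) (a : ℝ) (y : Fin n → ℝ) :
    (Fin.cons a y : Fin (n + 1) → ℝ) ⬝ᵥ (B *ᵥ (Fin.cons a y : Fin (n + 1) → ℝ)) =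
      (a + ∑ i, B 0 i.succ * y i) ^ 2 + y ⬝ᵥ (schurComplementZero B *ᵥ y) := by
  have hs : ∀ i : Fin n, B i.succ 0 = B 0 i.succ := fun i => hB.apply _ _
  have h2 : ∀ i : Fin n, (schurComplementZero B *ᵥ y) i =
      ∑ j, B i.succ j.succ * y j - B 0 i.succ * ∑ j, B 0 j.succ * y j := by
    intro i
    simp only [mulVec, dotProduct, schurComplementZero, of_apply, sub_mul,
      Finset.sum_sub_distrib, hs, Finset.mul_sum, mul_assoc]
  simp only [dotProduct, h2]
  simp only [mulVec, dotProduct, Fin.sum_univ_succ, Fin.cons_zero, Fin.cons_succ, h, hs, mul_add,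
    mul_sub, Finset.sum_add_distrib, Finset.sum_sub_distrib]
  have h3 : ∑ i, y i * (B 0 i.succ * a) = a * ∑ i, B 0 i.succ * y i := by
    rw [Finset.mul_sum]
    exact Finset.sum_congr rfl fun _ _ => by ring
  have h4 : ∀ t : ℝ, ∑ i, y i * (B 0 i.succ * t) = (∑ i, B 0 i.succ * y i) * t := by
    intro t
    rw [Finset.sum_mul]
    exact Finset.sum_congr rfl fun _ _ => by ring
  rw [h3, h4]
  ring

lemma posDef_schurComplementZero {n : ℕ} {B : Matrix (Fin (n + 1)) (Fin (n + 1)) ℝ}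
    (hB : B.PosDef) (h : B 0 0 = 1) : (schurComplementZero B).PosDef := by
  have hsymm : B.IsSymm := by
    simpa [IsHermitian, IsSymm, conjTranspose_eq_transpose_of_trivial] using hB.1
  refine PosDef.of_dotProduct_mulVec_pos ?_ fun y hy => ?_
  · ext i j
    simp only [conjTranspose_apply, schurComplementZero, of_apply, star_trivial,
      hsymm.apply i.succ j.succ, hsymm.apply i.succ 0, hsymm.apply 0 j.succ]
    ring
  · have hne : (Fin.cons (-∑ i, B 0 i.succ * y i) y : Fin (n + 1) → ℝ) ≠ 0 := fun h0 =>
      hy (funext fun i => by simpa using congrFun h0 i.succ)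
    have := hB.dotProduct_mulVec_pos hne
    rw [star_trivial, quadForm_cons hsymm h] at this
    simpa using this

/-- A positive definite matrix of determinant one is, in suitable orthonormal coordinates, the Gram
matrix of a lattice all of whose nonzero vectors have length at least one. -/
theorem Matrix.PosDef.exists_orthogonal_one_le_quadForm {n : ℕ} (A : Matrix (Fin n) (Fin n) ℝ)
    (hA : A.PosDef) (hdet : A.det = 1) :
    ∃ P : Matrix (Fin n) (Fin n) ℝ, Pᵀ * P = 1 ∧ ∀ e : Fin n → ℤ, e ≠ 0 →
      1 ≤ (P *ᵥ fun j => (e j : ℝ)) ⬝ᵥ (A *ᵥ (P *ᵥ fun j => (e j : ℝ))) := by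
  induction n with
  | zero => exact ⟨1, by simp, fun e he => (he (Subsingleton.elim _ _)).elim⟩
  | succ n ih =>
    obtain ⟨w, hw, hAw⟩ := hA.exists_unit_vector_quadForm_eq_one hdet
    obtain ⟨Q, hQ, hQw⟩ := exists_orthogonal_matrix_col_eq 0 w hw
    set B := Qᵀ * A * Q with hBdef
    have hquad : ∀ z, (Q *ᵥ z) ⬝ᵥ (A *ᵥ (Q *ᵥ z)) = z ⬝ᵥ (B *ᵥ z) := by
      intro z
      rw [hBdef, ← mulVec_mulVec, ← mulVec_mulVec, dotProduct_mulVec z, ← mulVec_transpose,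
        transpose_transpose]
    have hB : B.PosDef := by
      have := hA.conjTranspose_mul_mul_same (B := Q) (fun x y hxy => by
        simpa [mulVec_mulVec, hQ] using congrArg (Qᵀ *ᵥ ·) hxy)
      rwa [conjTranspose_eq_transpose_of_trivial] at this
    have hBsymm : B.IsSymm := by
      simpa [IsHermitian, IsSymm, conjTranspose_eq_transpose_of_trivial] using hB.1
    have hB0 : B 0 0 = 1 := by
      have hcol : Q *ᵥ Pi.single 0 1 = w := by
        ext i
        simp [hQw]
      have := hquad (Pi.single 0 1)
      rw [hcol, hAw] at this
      simpa using this.symm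
    have hBdet : B.det = 1 := by
      have hQdet : Q.det * Q.det = 1 := by simpa using congrArg det hQ
      rw [hBdef, det_mul, det_mul, det_transpose, hdet, mul_one, hQdet]
    obtain ⟨P, hP, hPe⟩ := ih (schurComplementZero B) (posDef_schurComplementZero hB hB0)
      ((det_schurComplementZero hB0).trans hBdet)
    let M : Matrix (Fin (n + 1)) (Fin (n + 1)) ℝ :=
      Matrix.of (Fin.cons (Fin.cons 1 0) fun i => Fin.cons 0 (P i))
    have hM : Mᵀ * M = 1 := by
      ext i j
      have hPij : ∀ i j, ∑ k, P k i * P k j = (1 : Matrix (Fin n) (Fin n) ℝ) i j := fun i j => by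
        rw [← hP, mul_apply]
        rfl
      cases i using Fin.cases <;> cases j using Fin.cases <;>
        simp [M, mul_apply, Fin.sum_univ_succ, hPij, one_apply, Fin.succ_ne_zero,
          (Fin.succ_ne_zero _).symm]
    refine ⟨Q * M, ?_, fun e he => ?_⟩
    · rw [transpose_mul, Matrix.mul_assoc, ← Matrix.mul_assoc Qᵀ, hQ, Matrix.one_mul, hM]
    have hMe : M *ᵥ (fun j => (e j : ℝ)) =
        Fin.cons (e 0 : ℝ) (P *ᵥ fun j => (e j.succ : ℝ)) := by
      ext i
      cases i using Fin.cases <;> simp [M, mulVec, dotProduct, Fin.sum_univ_succ]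
    rw [← mulVec_mulVec, hquad, hMe, quadForm_cons hBsymm hB0]
    by_cases ht : (fun j : Fin n => e j.succ) = 0
    · have hz : (fun j : Fin n => (e j.succ : ℝ)) = 0 := by
        ext j
        simpa using congrFun ht j
      have he0 : e 0 ≠ 0 := fun h0 => he <| funext fun i => by
        cases i using Fin.cases with
        | zero => exact h0
        | succ i => exact congrFun ht i
      have : (1 : ℤ) ≤ e 0 ^ 2 := by
        have : 0 < e 0 ^ 2 := by positivity
        omega
      rw [hz]
      simpa using (by exact_mod_cast this : (1 : ℝ) ≤ (e 0 : ℝ) ^ 2)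
    · exact (hPe _ ht).trans (le_add_of_nonneg_left (sq_nonneg _))

/-- upper bound on the optimal transmit power. For any diagonal
`S` with positive entries there is a precoder `F` whose received lattice has
squared minimum distance at least `1` and whose power satisfies
`tr(FᵀF) ≤ N (1/det S)^{2/N}`. -/
theorem transmit_power_upper_bound (N : ℕ) (hN : 0 < N)
    (s : Fin N → ℝ) (hs : ∀ j, 0 < s j) :
    ∃ F : Matrix (Fin N) (Fin N) ℝ,
      (∀ e : Fin N → ℤ, e ≠ 0 →
        1 ≤ ∑ i, ((Matrix.diagonal s * F).mulVec (fun j => (e j : ℝ)) i) ^ 2) ∧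
      (Fᵀ * F).trace ≤ (N : ℝ) * ((1 / ∏ j, s j) ^ ((2 : ℝ) / N)) := by
  have hprod : 0 < ∏ j, s j := Finset.prod_pos fun j _ => hs j
  have hN' : (N : ℝ) ≠ 0 := by positivity
  set c : ℝ := (1 / ∏ j, s j) ^ ((1 : ℝ) / N) with hc
  have hc0 : 0 < c := by positivity
  have hcN : c ^ N = 1 / ∏ j, s j := by
    rw [hc, ← Real.rpow_natCast, ← Real.rpow_mul (by positivity), one_div_mul_cancel hN',
      Real.rpow_one]
  have hc2 : c ^ 2 = (1 / ∏ j, s j) ^ ((2 : ℝ) / N) := by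
    rw [hc, ← Real.rpow_natCast, ← Real.rpow_mul (by positivity)]
    congr 1
    push_cast
    ring
  obtain ⟨P, hP, hPe⟩ := Matrix.PosDef.exists_orthogonal_one_le_quadForm
    (diagonal fun j => (s j * c) ^ 2)
    (PosDef.diagonal fun j => by have := hs j; positivity)
    (by
      rw [det_diagonal, Finset.prod_pow, Finset.prod_mul_distrib, Finset.prod_const,
        Finset.card_univ, Fintype.card_fin, hcN, mul_one_div_cancel hprod.ne', one_pow])
  refine ⟨c • P, fun e he => (hPe e he).trans_eq ?_, ?_⟩
  · refine Finset.sum_congr rfl fun i _ => ?_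
    rw [mulVec_diagonal, ← mulVec_mulVec, mulVec_diagonal, smul_mulVec, Pi.smul_apply,
      smul_eq_mul]
    ring
  · rw [← hc2, transpose_smul, smul_mul_smul_comm, hP, trace_smul, trace_one, Fintype.card_fin,
      smul_eq_mul]
    exact le_of_eq (by ring)
end

section
/- Bound on the optimal unimodular matrix: let S be a real N×N diagonal matrix with diagonal entries s₁ ≥ … ≥ s_N > 0 and define h(G) := inf over orthogonal N×N matrices U of tr(S⁻² U G Uᵀ). Suppose G_L is a positive definite real symmetric N×N matrix with smallest eigenvalue ω_N(G_L) > 0 and Z is a unimodular integer matrix such that G := Zᵀ G_L Z lies in R₁ and satisfies h(G) ≤ h(G') for every G' ∈ R₁. Then tr(Z Zᵀ) ≤ (N / ω_N(G_L)) · (s₁ / (det S)^{1/N})². -/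
open Matrix

/-- The Ryshkov polytope `R₁`. -/
def RyshkovOne (N : ℕ) : Set (Matrix (Fin N) (Fin N) ℝ) :=
  {G | G.IsSymm ∧ ∀ e : Fin N → ℤ, e ≠ 0 → 1 ≤ intQuadForm G e}

/-- The infimum over orthogonal matrices `U` of `tr(S⁻² U G Uᵀ)`. -/
noncomputable def orthInf {N : ℕ} (s : Fin N → ℝ)
    (G : Matrix (Fin N) (Fin N) ℝ) : ℝ :=
  sInf ((fun U : Matrix (Fin N) (Fin N) ℝ =>
      (Matrix.diagonal (fun j => 1 / (s j) ^ 2) * U * G * Uᵀ).trace) ''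
    {U | Uᵀ * U = 1})

theorem exists_ne_le_one_one_le_of_prod_eq_one {ι : Type*} [Fintype ι] [Nontrivial ι]
    (a : ι → ℝ) (ha : ∀ i, 0 < a i) (hprod : ∏ i, a i = 1) :
    ∃ i j, i ≠ j ∧ a i ≤ 1 ∧ 1 ≤ a j := by
  classical
  obtain ⟨i, hi⟩ : ∃ i, a i ≤ 1 := by
    by_contra! h
    have := Finset.prod_lt_prod_of_nonempty (s := Finset.univ) (f := fun _ : ι => (1 : ℝ))
      (g := a) (fun _ _ => one_pos) (fun i _ => h i) Finset.univ_nonempty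
    simp [hprod] at this
  have hne : (Finset.univ.erase i).Nonempty := by
    obtain ⟨j, hj⟩ := exists_ne i
    exact ⟨j, by simp [hj]⟩
  by_contra! h
  have hlt := Finset.prod_lt_prod_of_nonempty (s := Finset.univ.erase i) (f := a)
    (g := fun _ => (1 : ℝ)) (fun j _ => ha j)
    (fun j hj => h i j (Finset.ne_of_mem_erase hj).symm hi) hne
  have heq := Finset.mul_prod_erase Finset.univ a (Finset.mem_univ i)
  rw [Finset.prod_const_one] at hlt
  nlinarith [ha i, Finset.prod_pos (s := Finset.univ.erase i) fun j _ => ha j]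

/-- Extends a linear endomorphism by one coordinate and rotates the first two coordinates of
the result by the angle with cosine `c` and sine `t`. -/
def rotateCons {n : ℕ} (c t : ℝ) (f : (Fin (n + 1) → ℝ) →ₗ[ℝ] (Fin (n + 1) → ℝ)) :
    (Fin (n + 2) → ℝ) →ₗ[ℝ] (Fin (n + 2) → ℝ) where
  toFun x := Fin.cons (c * x 0 - t * f (Fin.tail x) 0)
    (Fin.cons (t * x 0 + c * f (Fin.tail x) 0) (Fin.tail (f (Fin.tail x))))
  map_add' x y := by
    have h : Fin.tail (x + y) = Fin.tail x + Fin.tail y := rfl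
    ext i
    refine Fin.cases ?_ (fun i => Fin.cases ?_ (fun i => ?_) i) i
    · simp [h]; ring
    · simp [h]; ring
    · simp [h, Fin.tail]
  map_smul' r x := by
    have h : Fin.tail (r • x) = r • Fin.tail x := rfl
    ext i
    refine Fin.cases ?_ (fun i => Fin.cases ?_ (fun i => ?_) i) i
    · simp [h]; ring
    · simp [h]; ring
    · simp [h, Fin.tail]

theorem rotateCons_dotProduct {n : ℕ} {c t : ℝ} (hct : c ^ 2 + t ^ 2 = 1)
    {f : (Fin (n + 1) → ℝ) →ₗ[ℝ] (Fin (n + 1) → ℝ)} (hf : ∀ x y, f x ⬝ᵥ f y = x ⬝ᵥ y)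
    (x y : Fin (n + 2) → ℝ) : rotateCons c t f x ⬝ᵥ rotateCons c t f y = x ⬝ᵥ y := by
  have h := hf (Fin.tail x) (Fin.tail y)
  simp only [dotProduct] at h ⊢
  rw [Fin.sum_univ_succ] at h
  rw [Fin.sum_univ_succ, Fin.sum_univ_succ, Fin.sum_univ_succ (fun i => x i * y i)]
  simp only [rotateCons, LinearMap.coe_mk, AddHom.coe_mk, Fin.cons_zero, Fin.cons_succ]
  simp only [Fin.tail] at h ⊢
  linear_combination h + hct *
    (x 0 * y 0 + f (Fin.tail x) 0 * f (Fin.tail y) 0)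

theorem sum_mul_sq_rotateCons {n : ℕ} {a : Fin (n + 2) → ℝ} {c t : ℝ}
    (hct : c ^ 2 + t ^ 2 = 1) (hac : a 0 * c ^ 2 + a 1 * t ^ 2 = 1)
    (f : (Fin (n + 1) → ℝ) →ₗ[ℝ] (Fin (n + 1) → ℝ)) (x : Fin (n + 2) → ℝ) :
    ∑ i, a i * rotateCons c t f x i ^ 2 =
      (x 0 + c * t * (a 1 - a 0) * f (Fin.tail x) 0) ^ 2 +
      ∑ i, (Fin.cons (a 0 * a 1) fun i : Fin n => a i.succ.succ : Fin (n + 1) → ℝ) i *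
        f (Fin.tail x) i ^ 2 := by
  rw [Fin.sum_univ_succ, Fin.sum_univ_succ, Fin.sum_univ_succ (n := n)]
  simp only [rotateCons, LinearMap.coe_mk, AddHom.coe_mk, Fin.cons_zero, Fin.cons_succ]
  simp only [Fin.succ_zero_eq_one, Fin.tail_def (q := f (Fin.tail x))]
  have key : a 0 * t ^ 2 + a 1 * c ^ 2 = (c * t * (a 1 - a 0)) ^ 2 + a 0 * a 1 := by
    linear_combination (a 0 * t ^ 2 + a 1 * c ^ 2) * (-hac) + a 0 * a 1 * (c ^ 2 + t ^ 2 + 1) * hct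
  linear_combination x 0 ^ 2 * hac + f (Fin.tail x) 0 ^ 2 * key

/-- A positive diagonal form of determinant one can be rotated so that it takes values at least
one on all nonzero integer vectors. -/
theorem exists_isometry_one_le_on_int (n : ℕ) (a : Fin n → ℝ) (ha : ∀ i, 0 < a i)
    (hprod : ∏ i, a i = 1) :
    ∃ f : (Fin n → ℝ) →ₗ[ℝ] (Fin n → ℝ), (∀ x y, f x ⬝ᵥ f y = x ⬝ᵥ y) ∧
      ∀ e : Fin n → ℤ, e ≠ 0 → 1 ≤ ∑ i, a i * f (fun i => (e i : ℝ)) i ^ 2 := by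
  induction n with
  | zero => exact ⟨LinearMap.id, fun _ _ => rfl, fun e he => (he (Subsingleton.elim _ _)).elim⟩
  | succ n ih =>
    cases n with
    | zero =>
      refine ⟨LinearMap.id, fun _ _ => rfl, fun e he => ?_⟩
      have he0 : e 0 ≠ 0 := fun h => he (by ext i; rw [Fin.fin_one_eq_zero i, h]; rfl)
      have ha1 : a 0 = 1 := by simpa using hprod
      simpa [ha1] using Int.cast_one_le_of_pos (R := ℝ) (pow_pos (abs_pos.mpr he0) 2)
    | succ n =>
      obtain ⟨i, j, hij, hi, hj⟩ := exists_ne_le_one_one_le_of_prod_eq_one a ha hprod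
      obtain ⟨σ, hσ0, hσ1⟩ : ∃ σ : Equiv.Perm (Fin (n + 2)), σ 0 = i ∧ σ 1 = j := by
        have hk : Equiv.swap 0 i j ≠ 0 := fun h => hij (by
          have := congrArg (Equiv.swap 0 i) h
          simpa using this.symm)
        refine ⟨(Equiv.swap 1 (Equiv.swap 0 i j)).trans (Equiv.swap 0 i), ?_, by simp⟩
        rw [Equiv.trans_apply, Equiv.swap_apply_of_ne_of_ne (by simp) hk.symm,
          Equiv.swap_apply_left]
      obtain ⟨c, t, hct, hac⟩ : ∃ c t : ℝ, c ^ 2 + t ^ 2 = 1 ∧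
          a (σ 0) * c ^ 2 + a (σ 1) * t ^ 2 = 1 := by
        rw [hσ0, hσ1]
        rcases eq_or_lt_of_le (hi.trans hj) with h | h
        · exact ⟨1, 0, by simp, by simp; linarith⟩
        · have hd : 0 < a j - a i := sub_pos.mpr h
          refine ⟨√((a j - 1) / (a j - a i)), √((1 - a i) / (a j - a i)), ?_, ?_⟩ <;>
          · rw [Real.sq_sqrt (div_nonneg (by linarith) hd.le),
              Real.sq_sqrt (div_nonneg (by linarith) hd.le)]
            field_simp
            ring
      have hprod' : a (σ 0) * (a (σ 1) * ∏ k : Fin n, a (σ k.succ.succ)) = 1 := by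
        rw [← hprod, ← Equiv.prod_comp σ, Fin.prod_univ_succ, Fin.prod_univ_succ]
        simp
      obtain ⟨f, hf, hfe⟩ := ih (Fin.cons (a (σ 0) * a (σ 1)) fun k => a (σ k.succ.succ))
        (fun k => Fin.cases (by simpa using mul_pos (ha _) (ha _)) (fun k => by simpa using ha _) k)
        (by rw [Fin.prod_univ_succ]; simpa [mul_assoc] using hprod')
      refine ⟨LinearMap.funLeft ℝ ℝ σ.symm ∘ₗ rotateCons c t f, fun x y => ?_, fun e he => ?_⟩
      · rw [← rotateCons_dotProduct hct hf x y]
        simp only [dotProduct, LinearMap.comp_apply, LinearMap.funLeft_apply]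
        exact Equiv.sum_comp σ.symm fun i => rotateCons c t f x i * rotateCons c t f y i
      · rw [← Equiv.sum_comp σ]
        simp only [LinearMap.comp_apply, LinearMap.funLeft_apply, Equiv.symm_apply_apply]
        rw [sum_mul_sq_rotateCons (a := fun k => a (σ k)) hct hac]
        by_cases ht : Fin.tail e = 0
        · have hz : (Fin.tail fun i => (e i : ℝ)) = 0 := by
            ext k
            exact congrArg (Int.cast : ℤ → ℝ) (congrFun ht k) |>.trans Int.cast_zero
          have he0 : e 0 ≠ 0 := fun h => he (by
            ext k
            exact Fin.cases h (fun k => congrFun ht k) k)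
          simpa [hz] using Int.cast_one_le_of_pos (R := ℝ) (pow_pos (abs_pos.mpr he0) 2)
        · exact (hfe _ ht).trans (le_add_of_nonneg_left (sq_nonneg _))

theorem mul_trace_le_trace_diagonal_mul {n : Type*} [Fintype n] [DecidableEq n]
    {d : n → ℝ} {m : ℝ} (hd : ∀ i, m ≤ d i) {P : Matrix n n ℝ} (hP : P.PosSemidef) :
    m * P.trace ≤ (diagonal d * P).trace := by
  simp only [trace, diag_apply, diagonal_mul, Finset.mul_sum]
  exact Finset.sum_le_sum fun i _ => mul_le_mul_of_nonneg_right (hd i) hP.diag_nonneg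

theorem Matrix.IsHermitian.mul_trace_mul_transpose_le {n : Type*} [Fintype n] [DecidableEq n]
    {A : Matrix n n ℝ} (hA : A.IsHermitian) {m : ℝ} (hm : ∀ i, m ≤ hA.eigenvalues i)
    (B : Matrix n n ℝ) : m * (B * Bᵀ).trace ≤ (Bᵀ * A * B).trace := by
  set V : Matrix n n ℝ := ↑hA.eigenvectorUnitary with hV
  have hVV : V * Vᵀ = 1 := by
    simpa [star_eq_conjTranspose] using Unitary.coe_mul_star_self hA.eigenvectorUnitary
  have hsp : A = V * diagonal hA.eigenvalues * Vᵀ := by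
    conv_lhs => rw [hA.spectral_theorem, Unitary.conjStarAlgAut_apply]
    simp [star_eq_conjTranspose, hV]
  have hP : ((Vᵀ * B) * (Vᵀ * B)ᵀ).PosSemidef := by
    simpa using posSemidef_self_mul_conjTranspose (Vᵀ * B)
  have h := mul_trace_le_trace_diagonal_mul hm hP
  have h1 : ((Vᵀ * B) * (Vᵀ * B)ᵀ).trace = (B * Bᵀ).trace := by
    rw [transpose_mul, transpose_transpose, Matrix.mul_assoc, trace_mul_comm,
      Matrix.mul_assoc, Matrix.mul_assoc, hVV, Matrix.mul_one]
  have h2 : (Bᵀ * A * B).trace =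
      (diagonal hA.eigenvalues * ((Vᵀ * B) * (Vᵀ * B)ᵀ)).trace := by
    conv_lhs => rw [hsp]
    rw [transpose_mul, transpose_transpose, ← Matrix.mul_assoc (diagonal _),
      trace_mul_comm _ (Bᵀ * V)]
    simp only [Matrix.mul_assoc]
  rwa [h1, ← h2] at h

theorem mul_trace_le_trace_conj {N : ℕ} {s : Fin N → ℝ} {m : ℝ}
    (hm : ∀ j, m ≤ 1 / s j ^ 2) {G : Matrix (Fin N) (Fin N) ℝ} (hG : G.PosSemidef)
    {U : Matrix (Fin N) (Fin N) ℝ} (hU : Uᵀ * U = 1) :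
    m * G.trace ≤ (diagonal (fun j => 1 / s j ^ 2) * U * G * Uᵀ).trace := by
  have h := mul_trace_le_trace_diagonal_mul hm
    (by simpa using hG.mul_mul_conjTranspose_same U : (U * G * Uᵀ).PosSemidef)
  rw [trace_mul_cycle, hU, Matrix.one_mul] at h
  simpa only [Matrix.mul_assoc] using h

theorem mul_trace_le_orthInf {N : ℕ} {s : Fin N → ℝ} {m : ℝ}
    (hm : ∀ j, m ≤ 1 / s j ^ 2) {G : Matrix (Fin N) (Fin N) ℝ} (hG : G.PosSemidef) :
    m * G.trace ≤ orthInf s G := by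
  refine le_csInf (Set.Nonempty.image _ ⟨1, by simp⟩) ?_
  rintro _ ⟨U, hU, rfl⟩
  exact mul_trace_le_trace_conj hm hG hU

theorem orthInf_le {N : ℕ} (s : Fin N → ℝ) {G : Matrix (Fin N) (Fin N) ℝ} (hG : G.PosSemidef)
    {U : Matrix (Fin N) (Fin N) ℝ} (hU : Uᵀ * U = 1) :
    orthInf s G ≤ (diagonal (fun j => 1 / s j ^ 2) * U * G * Uᵀ).trace := by
  refine csInf_le ⟨0, ?_⟩ ⟨U, hU, rfl⟩
  rintro _ ⟨W, hW, rfl⟩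
  simpa using mul_trace_le_trace_conj (m := 0) (s := s) (fun j => by positivity) hG hW

/-- The Ryshkov polytope contains a form whose `orthInf` attains the lower bound given by the
inequality of arithmetic and geometric means for forms of determinant one. -/
theorem exists_mem_ryshkovOne_orthInf_le {N : ℕ} (s : Fin N → ℝ) (hs : ∀ j, 0 < s j) {c : ℝ}
    (hc : 0 < c) (hprod : c ^ N = ∏ j, s j) :
    ∃ G ∈ RyshkovOne N, orthInf s G ≤ N / c ^ 2 := by
  set a : Fin N → ℝ := fun i => (s i / c) ^ 2 with ha
  have ha0 : ∀ i, 0 < a i := fun i => pow_pos (div_pos (hs i) hc) 2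
  have ha1 : ∏ i, a i = 1 := by
    rw [Finset.prod_pow, Finset.prod_div_distrib, ← hprod]
    simp [hc.ne']
  obtain ⟨f, hf, hfe⟩ := exists_isometry_one_le_on_int N a ha0 ha1
  set V := LinearMap.toMatrix' f with hVdef
  have hfV : ∀ x, V *ᵥ x = f x := fun x => LinearMap.toMatrix'_mulVec f x
  have hV : Vᵀ * V = 1 := by
    ext i j
    have h := hf (Pi.single i 1) (Pi.single j 1)
    rw [← hfV, ← hfV, mulVec_single_one, mulVec_single_one] at h
    rw [mul_apply', one_apply]
    simpa [Pi.single_apply, eq_comm, dotProduct, col_apply] using h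
  have hV' : V * Vᵀ = 1 := mul_eq_one_comm.mp hV
  have hG : (Vᵀ * diagonal a * V).PosSemidef := by
    simpa using (PosSemidef.diagonal fun i => (ha0 i).le).conjTranspose_mul_mul_same V
  refine ⟨Vᵀ * diagonal a * V, ⟨?_, fun e he => ?_⟩, (orthInf_le s hG hV).trans_eq ?_⟩
  · simp [IsSymm, transpose_mul, Matrix.mul_assoc]
  · convert hfe e he using 1
    rw [intQuadForm, ← mulVec_mulVec, ← mulVec_mulVec, dotProduct_mulVec, vecMul_transpose, hfV]
    simp only [dotProduct, mulVec_diagonal]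
    exact Finset.sum_congr rfl fun i _ => by ring
  · rw [show diagonal (fun j => 1 / s j ^ 2) * V * (Vᵀ * diagonal a * V) * Vᵀ =
      diagonal (fun j => 1 / s j ^ 2) * (V * Vᵀ) * diagonal a * (V * Vᵀ) by
        simp only [Matrix.mul_assoc], hV', Matrix.mul_one, Matrix.mul_one, diagonal_mul_diagonal,
      trace_diagonal, Finset.sum_congr rfl fun i _ => (?_ : _ = 1 / c ^ 2)]
    · simp [div_eq_mul_inv]
    · have := (hs i).ne'
      simp only [ha]
      field_simp

/-- bound on the optimal unimodular matrix. If `G = ZᵀG_L Z ∈ R₁`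
minimizes `h` over `R₁`, where `G_L` is positive definite with smallest
eigenvalue `ω_N(G_L) > 0`, then `tr(ZZᵀ) ≤ (N/ω_N(G_L)) (s₁/(det S)^{1/N})²`. -/
theorem optimal_unimodular_bound (N : ℕ) (hN : 0 < N)
    (s : Fin N → ℝ) (hs : ∀ j, 0 < s j) (hs_mono : Antitone s)
    (Gmat : Matrix (Fin N) (Fin N) ℝ) (hGL : Gmat.PosDef)
    (ωN : ℝ) (hω : IsLeast (Set.range hGL.1.eigenvalues) ωN) (hωpos : 0 < ωN)
    (Z : Matrix (Fin N) (Fin N) ℤ) (hZ : IsUnimodular Z)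
    (hmem : (Z.map (Int.cast : ℤ → ℝ))ᵀ * Gmat * Z.map (Int.cast : ℤ → ℝ) ∈
      RyshkovOne N)
    (hopt : ∀ G' ∈ RyshkovOne N,
      orthInf s ((Z.map (Int.cast : ℤ → ℝ))ᵀ * Gmat * Z.map (Int.cast : ℤ → ℝ)) ≤
        orthInf s G') :
    ((Z.map (Int.cast : ℤ → ℝ)) * (Z.map (Int.cast : ℤ → ℝ))ᵀ).trace ≤
      ((N : ℝ) / ωN) * (s ⟨0, hN⟩ / (∏ j, s j) ^ ((1 : ℝ) / N)) ^ 2 := by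
  set ZR : Matrix (Fin N) (Fin N) ℝ := Z.map (Int.cast : ℤ → ℝ)
  set c : ℝ := (∏ j, s j) ^ ((1 : ℝ) / N)
  have hdet : 0 < ∏ j, s j := Finset.prod_pos fun j _ => hs j
  have hc : 0 < c := Real.rpow_pos_of_pos hdet _
  have hcN : c ^ N = ∏ j, s j := by
    simpa [c] using Real.rpow_inv_natCast_pow hdet.le hN.ne'
  have hs0 : 0 < s ⟨0, hN⟩ := hs _
  obtain ⟨G', hG', hle⟩ := exists_mem_ryshkovOne_orthInf_le s hs hc hcN
  have hPSD : (ZRᵀ * Gmat * ZR).PosSemidef := by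
    simpa using hGL.posSemidef.conjTranspose_mul_mul_same ZR
  have hm : ∀ j, 1 / s ⟨0, hN⟩ ^ 2 ≤ 1 / s j ^ 2 := fun j =>
    one_div_le_one_div_of_le (pow_pos (hs j) 2)
      (pow_le_pow_left₀ (hs j).le (hs_mono (Fin.mk_le_of_le_val (Nat.zero_le _))) 2)
  have h1 := (mul_trace_le_orthInf hm hPSD).trans ((hopt G' hG').trans hle)
  have h2 := hGL.1.mul_trace_mul_transpose_le (fun i => hω.2 ⟨i, rfl⟩) ZR
  rw [one_div, inv_mul_le_iff₀ (pow_pos hs0 2)] at h1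
  calc (ZR * ZRᵀ).trace ≤ (s ⟨0, hN⟩ ^ 2 * (N / c ^ 2)) / ωN := by
        rw [le_div_iff₀' hωpos]
        exact h2.trans h1
    _ = (N / ωN) * (s ⟨0, hN⟩ / c) ^ 2 := by field_simp
end
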